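/- arXiv:2308.01620 — 6 statements merged into one kernel-verified Lean document; each statement's English description precedes it below -/
import Mathlib

section
/- Let 1 ≤ p ≤ ∞, let X and Y be metric spaces with Borel probability measures m_X and m_Y, and let X ×_p Y denote the product space X × Y equipped with the ℓ_p-product metric (d_X(x,x')^p + d_Y(y,y')^p)^{1/p} (max of the two distances when p = ∞) and the product measure m_X ⊗ m_Y. Then V(X ×_p Y) ≤ V(X) + V(Y) (an inequality in [0,∞]). -/
open MeasureTheory ENNReal

/-- The variance of a function `f` over `(X, m)` :
`V_X(f) = (1/2) ∫_{X×X} (f x − f y)² d(m ⊗ m)`, valued in `[0,∞]`. -/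
noncomputable def funVariance {X : Type*} [MeasurableSpace X]
    (m : Measure X) (f : X → ℝ) : ℝ≥0∞ :=
  (1 / 2) * ∫⁻ p : X × X, ENNReal.ofReal ((f p.1 - f p.2) ^ 2) ∂(m.prod m)

/-- The `ℓ_p`-product distance on `X × Y`:
`(d_X(x,x')^p + d_Y(y,y')^p)^(1/p)` for `p < ∞`, and the max of the two distances
for `p = ∞`. -/
noncomputable def lpProdDist {X Y : Type*} [MetricSpace X] [MetricSpace Y]
    (p : ℝ≥0∞) (a b : X × Y) : ℝ :=
  if p = ∞ then max (dist a.1 b.1) (dist a.2 b.2)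
  else (dist a.1 b.1 ^ p.toReal + dist a.2 b.2 ^ p.toReal) ^ (1 / p.toReal)

theorem lpProdDist_snd {X Y : Type*} [MetricSpace X] [MetricSpace Y]
    (p : ℝ≥0∞) (hp : 1 ≤ p) (x : X) (y y' : Y) :
    lpProdDist p (x, y) (x, y') = dist y y' := by
  unfold lpProdDist
  split_ifs with h
  · simp
  · have h0 : p.toReal ≠ 0 := (ENNReal.toReal_pos (by rintro rfl; simp at hp) h).ne'
    simp only [dist_self, Real.zero_rpow h0, zero_add, one_div]
    exact Real.rpow_rpow_inv dist_nonneg h0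

theorem lpProdDist_fst {X Y : Type*} [MetricSpace X] [MetricSpace Y]
    (p : ℝ≥0∞) (hp : 1 ≤ p) (x x' : X) (y : Y) :
    lpProdDist p (x, y) (x', y) = dist x x' := by
  unfold lpProdDist
  split_ifs with h
  · simp
  · have h0 : p.toReal ≠ 0 := (ENNReal.toReal_pos (by rintro rfl; simp at hp) h).ne'
    simp only [dist_self, Real.zero_rpow h0, add_zero, one_div]
    exact Real.rpow_rpow_inv dist_nonneg h0

theorem lint_key {X : Type*} [MeasurableSpace X] (m : Measure X) [IsProbabilityMeasure m]
    (u v : X → ℝ) (hu : MemLp u 2 m) (hv : MemLp v 2 m) :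
    ∫⁻ p : X × X, ENNReal.ofReal ((u p.1 - v p.2) ^ 2) ∂(m.prod m) =
      ENNReal.ofReal (ProbabilityTheory.variance u m + ProbabilityTheory.variance v m
        + ((∫ x, u x ∂m) - ∫ x, v x ∂m) ^ 2) := by
  have hu1 : Integrable u m := hu.integrable (by norm_num)
  have hv1 : Integrable v m := hv.integrable (by norm_num)
  have hu2 : Integrable (fun p : X × X => (u p.1) ^ 2) (m.prod m) :=
    hu.integrable_sq.comp_fst m
  have hv2 : Integrable (fun p : X × X => (v p.2) ^ 2) (m.prod m) :=
    hv.integrable_sq.comp_snd m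
  have huv : Integrable (fun p : X × X => u p.1 * v p.2) (m.prod m) := hu1.mul_prod hv1
  have e : (fun p : X × X => (u p.1 - v p.2) ^ 2) =
      fun p => ((u p.1) ^ 2 + (v p.2) ^ 2) - 2 * (u p.1 * v p.2) := by
    funext p; ring
  have hi : Integrable (fun p : X × X => (u p.1 - v p.2) ^ 2) (m.prod m) := by
    rw [e]; exact (hu2.add hv2).sub (huv.const_mul 2)
  rw [← ofReal_integral_eq_lintegral_ofReal hi (Filter.Eventually.of_forall fun p => sq_nonneg _)]
  congr 1
  have e1 : ∫ p : X × X, (u p.1) ^ 2 ∂(m.prod m) = ∫ x, u x ^ 2 ∂m := by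
    have := integral_fun_fst (μ := m) (ν := m) (fun x => u x ^ 2)
    simpa using this
  have e2 : ∫ p : X × X, (v p.2) ^ 2 ∂(m.prod m) = ∫ x, v x ^ 2 ∂m := by
    have := integral_fun_snd (μ := m) (ν := m) (fun x => v x ^ 2)
    simpa using this
  have huv2 : Integrable (fun p : X × X => u p.1 ^ 2 + v p.2 ^ 2) (m.prod m) := hu2.add hv2
  rw [e, integral_sub huv2 (huv.const_mul 2), integral_add hu2 hv2,
    integral_const_mul, integral_prod_mul, e1, e2, ProbabilityTheory.variance_eq_sub hu,
    ProbabilityTheory.variance_eq_sub hv]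
  simp only [Pi.pow_apply]
  ring

theorem memLp_of_funVariance {X : Type*} [MeasurableSpace X] (m : Measure X)
    [IsProbabilityMeasure m] (u : X → ℝ) (hu : Measurable u) (h : funVariance m u ≠ ∞) :
    MemLp u 2 m := by
  have h1 : ∫⁻ p : X × X, ENNReal.ofReal ((u p.1 - u p.2) ^ 2) ∂(m.prod m) ≠ ∞ := by
    intro h'
    apply h
    unfold funVariance
    rw [h']
    exact ENNReal.mul_top (by simp)
  have hm : Measurable fun p : X × X => ENNReal.ofReal ((u p.1 - u p.2) ^ 2) := by fun_prop
  rw [lintegral_prod_symm _ hm.aemeasurable] at h1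
  have h2 := ae_lt_top (Measurable.lintegral_prod_left' hm) h1
  obtain ⟨c, hc⟩ := h2.exists
  have h3 : MemLp (fun x => u x - u c) 2 m := by
    rw [memLp_two_iff_integrable_sq (by fun_prop)]
    refine ⟨by fun_prop, ?_⟩
    rw [hasFiniteIntegral_iff_ofReal (Filter.Eventually.of_forall fun p => sq_nonneg _)]
    exact hc
  have := h3.add (memLp_const (u c))
  simpa [Pi.add_def] using this

theorem funVariance_eq {X : Type*} [MeasurableSpace X] (m : Measure X)
    [IsProbabilityMeasure m] (u : X → ℝ) (hu : MemLp u 2 m) :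
    funVariance m u = ENNReal.ofReal (ProbabilityTheory.variance u m) := by
  unfold funVariance
  rw [lint_key m u u hu hu, sub_self, zero_pow two_ne_zero, add_zero, ← two_mul,
    ENNReal.ofReal_mul (by norm_num), ← mul_assoc]
  simp [ENNReal.inv_mul_cancel]

theorem lint_swap {X Y : Type*} [MeasurableSpace X] [MeasurableSpace Y]
    (mX : Measure X) (mY : Measure Y) [IsProbabilityMeasure mX] [IsProbabilityMeasure mY]
    (h : (X × Y) × (X × Y) → ℝ≥0∞) (hm : Measurable h) :
    ∫⁻ q, h q ∂((mX.prod mY).prod (mX.prod mY)) =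
      ∫⁻ y, ∫⁻ y', ∫⁻ x, ∫⁻ x', h ((x, y), (x', y')) ∂mX ∂mX ∂mY ∂mY := by
  rw [lintegral_prod _ hm.aemeasurable,
    lintegral_prod_symm _ (Measurable.lintegral_prod_right' hm).aemeasurable]
  refine lintegral_congr fun y => ?_
  have h1 : ∀ x, ∫⁻ b, h ((x, y), b) ∂(mX.prod mY) =
      ∫⁻ y', ∫⁻ x', h ((x, y), (x', y')) ∂mX ∂mY := fun x =>
    lintegral_prod_symm _ (by fun_prop)
  simp_rw [h1]
  apply lintegral_lintegral_swap
  apply Measurable.aemeasurable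
  exact Measurable.lintegral_prod_right'
    (f := fun r : (X × Y) × X => h ((r.1.1, y), (r.2, r.1.2))) (by fun_prop)


/-- The variance of the `ℓ_p`-product of two metric measure spaces is at most the
sum of the variances: `V(X ×_p Y) ≤ V(X) + V(Y)` in `[0,∞]`. -/
theorem variance_prod_le {X Y : Type*} [MetricSpace X] [MetricSpace Y]
    [MeasurableSpace X] [MeasurableSpace Y] [BorelSpace X] [BorelSpace Y]
    (mX : Measure X) (mY : Measure Y) [IsProbabilityMeasure mX] [IsProbabilityMeasure mY]
    (p : ℝ≥0∞) (hp : 1 ≤ p) :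
    (⨆ f ∈ {f : X × Y → ℝ | ∀ a b, |f a - f b| ≤ lpProdDist p a b},
        funVariance (mX.prod mY) f) ≤
      (⨆ f ∈ {f : X → ℝ | LipschitzWith 1 f}, funVariance mX f) +
        (⨆ f ∈ {f : Y → ℝ | LipschitzWith 1 f}, funVariance mY f) := by
  set A := ⨆ f ∈ {f : X → ℝ | LipschitzWith 1 f}, funVariance mX f with hA
  set B := ⨆ f ∈ {f : Y → ℝ | LipschitzWith 1 f}, funVariance mY f with hB
  by_cases hAt : A = ∞
  · simp [hAt]
  refine iSup₂_le fun f hf => ?_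
  have hfX : ∀ y, LipschitzWith 1 fun x => f (x, y) := fun y =>
    LipschitzWith.of_dist_le_mul fun x x' => by
      have := hf (x, y) (x', y)
      rw [lpProdDist_fst p hp] at this
      simpa [Real.dist_eq] using this
  have hfY : ∀ x y y', |f (x, y) - f (x, y')| ≤ dist y y' := fun x y y' => by
    have := hf (x, y) (x, y')
    rwa [lpProdDist_snd p hp] at this
  have hVA : ∀ y, funVariance mX (fun x => f (x, y)) ≤ A := fun y =>
    le_iSup₂_of_le (fun x => f (x, y)) (hfX y) le_rfl
  have hL : ∀ y, MemLp (fun x => f (x, y)) 2 mX := fun y =>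
    memLp_of_funVariance mX _ (hfX y).continuous.measurable (ne_top_of_le_ne_top hAt (hVA y))
  have hI : ∀ y, Integrable (fun x => f (x, y)) mX := fun y => (hL y).integrable (by norm_num)
  let g : Y → ℝ := fun y => ∫ x, f (x, y) ∂mX
  have hg : LipschitzWith 1 g := LipschitzWith.of_dist_le_mul fun y y' => by
    simp only [g, Real.dist_eq, NNReal.coe_one, one_mul]
    rw [← integral_sub (hI y) (hI y')]
    have := norm_integral_le_of_norm_le_const (μ := mX) (C := dist y y')
      (f := fun x => f (x, y) - f (x, y')) (Filter.Eventually.of_forall fun x => hfY x y y')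
    simpa using this
  have hgm : Measurable g := hg.continuous.measurable
  have hVB : funVariance mY g ≤ B := le_iSup₂_of_le g hg le_rfl
  obtain ⟨h, hm, hle, heq⟩ := exists_measurable_le_lintegral_eq ((mX.prod mY).prod (mX.prod mY))
    (fun q : (X × Y) × (X × Y) => ENNReal.ofReal ((f q.1 - f q.2) ^ 2))
  have hbound : ∀ y y', ∫⁻ x, ∫⁻ x', h ((x, y), (x', y')) ∂mX ∂mX ≤
      2 * A + ENNReal.ofReal ((g y - g y') ^ 2) := fun y y' => by
    have hmy : Measurable fun x => f (x, y) := (hfX y).continuous.measurable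
    have hmy' : Measurable fun x => f (x, y') := (hfX y').continuous.measurable
    calc ∫⁻ x, ∫⁻ x', h ((x, y), (x', y')) ∂mX ∂mX
        ≤ ∫⁻ x, ∫⁻ x', ENNReal.ofReal ((f (x, y) - f (x', y')) ^ 2) ∂mX ∂mX :=
          lintegral_mono fun x => lintegral_mono fun x' => hle ((x, y), (x', y'))
      _ = ∫⁻ q : X × X, ENNReal.ofReal ((f (q.1, y) - f (q.2, y')) ^ 2) ∂(mX.prod mX) := by
          refine (lintegral_prod (fun q : X × X =>
            ENNReal.ofReal ((f (q.1, y) - f (q.2, y')) ^ 2)) ?_).symm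
          exact (((hmy.comp measurable_fst).sub (hmy'.comp measurable_snd)).pow_const
            2).ennreal_ofReal.aemeasurable
      _ = ENNReal.ofReal _ := lint_key mX _ _ (hL y) (hL y')
      _ ≤ 2 * A + ENNReal.ofReal ((g y - g y') ^ 2) := by
          rw [ENNReal.ofReal_add (add_nonneg (ProbabilityTheory.variance_nonneg _ _)
            (ProbabilityTheory.variance_nonneg _ _)) (sq_nonneg _),
            ENNReal.ofReal_add (ProbabilityTheory.variance_nonneg _ _)
            (ProbabilityTheory.variance_nonneg _ _), ← funVariance_eq mX _ (hL y),
            ← funVariance_eq mX _ (hL y'), two_mul]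
          exact add_le_add (add_le_add (hVA y) (hVA y')) le_rfl
  have hgm2 : Measurable fun q : Y × Y => ENNReal.ofReal ((g q.1 - g q.2) ^ 2) := by fun_prop
  have hfin : ∫⁻ q, h q ∂((mX.prod mY).prod (mX.prod mY)) ≤
      2 * A + ∫⁻ q : Y × Y, ENNReal.ofReal ((g q.1 - g q.2) ^ 2) ∂(mY.prod mY) := by
    rw [lint_swap mX mY h hm]
    calc _ ≤ ∫⁻ y, ∫⁻ y', (2 * A + ENNReal.ofReal ((g y - g y') ^ 2)) ∂mY ∂mY :=
          lintegral_mono fun y => lintegral_mono fun y' => hbound y y'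
      _ = ∫⁻ q : Y × Y, (2 * A + ENNReal.ofReal ((g q.1 - g q.2) ^ 2)) ∂(mY.prod mY) :=
          (lintegral_prod (fun q : Y × Y => 2 * A + ENNReal.ofReal ((g q.1 - g q.2) ^ 2))
            (by fun_prop)).symm
      _ = _ := by
          rw [lintegral_add_left measurable_const]
          simp
  calc funVariance (mX.prod mY) f
      = (1 / 2) * ∫⁻ q, h q ∂((mX.prod mY).prod (mX.prod mY)) := by
        unfold funVariance; rw [heq]
    _ ≤ (1 / 2) * (2 * A + ∫⁻ q : Y × Y, ENNReal.ofReal ((g q.1 - g q.2) ^ 2) ∂(mY.prod mY)) := by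
        gcongr
    _ = A + funVariance mY g := by
        unfold funVariance
        rw [mul_add, ← mul_assoc]
        simp [ENNReal.inv_mul_cancel]
    _ ≤ A + B := by gcongr
end

section
/- Let p ∈ [1,∞), let Y be a complete separable metric space, and let μ_n (n ∈ ℕ) and μ be Borel probability measures on Y such that μ_n converges weakly to μ. Then V^(p)(Y,μ) ≤ liminf_{n→∞} V^(p)(Y,μ_n); that is, the p-variance is lower semicontinuous under weak convergence of probability measures. -/
open MeasureTheory ENNReal Filter

/-- The `p`-variance of a metric measure space `(Y, μ)` :
`V^(p)(Y,μ) = sup { ∫ |f − ∫ f dμ|^p dμ : f bounded and 1-Lipschitz }`, valued in `[0,∞]`. -/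
noncomputable def pVariance {Y : Type*} [MetricSpace Y] [MeasurableSpace Y]
    (p : ℝ) (μ : Measure Y) : ℝ≥0∞ :=
  ⨆ f ∈ {f : Y → ℝ | LipschitzWith 1 f ∧ ∃ C : ℝ, ∀ x, |f x| ≤ C},
    ∫⁻ x, ENNReal.ofReal (|f x - ∫ y, f y ∂μ| ^ p) ∂μ

/-- The `p`-variance is lower semicontinuous with respect to weak convergence of
Borel probability measures on a complete separable metric space. -/
theorem pVariance_lsc_weak_conv {Y : Type*} [MetricSpace Y] [CompleteSpace Y]
    [TopologicalSpace.SeparableSpace Y] [MeasurableSpace Y] [BorelSpace Y]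
    (p : ℝ) (hp : 1 ≤ p)
    (μs : ℕ → Measure Y) (μ : Measure Y)
    [∀ n, IsProbabilityMeasure (μs n)] [IsProbabilityMeasure μ]
    (hconv : ∀ g : Y → ℝ, Continuous g → (∃ C : ℝ, ∀ x, |g x| ≤ C) →
      Tendsto (fun n => ∫ x, g x ∂(μs n)) atTop (nhds (∫ x, g x ∂μ))) :
    pVariance p μ ≤ liminf (fun n => pVariance p (μs n)) atTop := by
  unfold pVariance
  refine iSup₂_le fun f hf => ?_
  obtain ⟨hL, C, hC⟩ := id hf
  have hfc : Continuous f := hL.continuous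
  have hp0 : 0 ≤ p := by linarith
  have hint : ∀ (ν : Measure Y) [IsProbabilityMeasure ν] (g : Y → ℝ) (K : ℝ), Continuous g →
      (∀ x, |g x| ≤ K) → Integrable g ν := by
    intro ν _ g K hg hK
    exact Integrable.of_bound hg.aestronglyMeasurable K (Eventually.of_forall hK)
  have hav : ∀ (ν : Measure Y) [IsProbabilityMeasure ν], |∫ y, f y ∂ν| ≤ C := by
    intro ν _
    have := norm_integral_le_of_norm_le_const (μ := ν) (f := f) (C := C) (Eventually.of_forall hC)
    simpa using this
  have hpc : Continuous (fun t : ℝ => |t| ^ p) :=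
    continuous_abs.rpow_const (fun _ => Or.inr hp0)
  have hgc : ∀ a : ℝ, Continuous (fun x => |f x - a| ^ p) := fun a =>
    hpc.comp (hfc.sub continuous_const)
  have hmem : ∀ x a, |a| ≤ C → |f x - a| ≤ 2 * C := by
    intro x a ha
    have := abs_sub (f x) a
    linarith [hC x]
  have hgb : ∀ a : ℝ, |a| ≤ C → ∀ x, |(|f x - a| ^ p)| ≤ (2 * C) ^ p := by
    intro a ha x
    rw [abs_of_nonneg (by positivity)]
    exact Real.rpow_le_rpow (abs_nonneg _) (hmem x a ha) hp0
  have heq : ∀ (ν : Measure Y) [IsProbabilityMeasure ν],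
      ∫⁻ x, ENNReal.ofReal (|f x - ∫ y, f y ∂ν| ^ p) ∂ν
        = ENNReal.ofReal (∫ x, |f x - ∫ y, f y ∂ν| ^ p ∂ν) := by
    intro ν _
    rw [ofReal_integral_eq_lintegral_ofReal (hint ν _ _ (hgc _) (hgb _ (hav ν)))]
    exact Eventually.of_forall fun x => by positivity
  have ha := hconv f hfc ⟨C, hC⟩
  have h1 := hconv _ (hgc (∫ y, f y ∂μ)) ⟨_, hgb _ (hav μ)⟩
  have h2 : Tendsto (fun n => (∫ x, |f x - ∫ y, f y ∂(μs n)| ^ p ∂(μs n))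
      - ∫ x, |f x - ∫ y, f y ∂μ| ^ p ∂(μs n)) atTop (nhds 0) := by
    rw [Metric.tendsto_nhds]
    intro ε hε
    have huc := (isCompact_Icc (a := -(2 * C)) (b := 2 * C)).uniformContinuousOn_of_continuous
      hpc.continuousOn
    rw [Metric.uniformContinuousOn_iff] at huc
    obtain ⟨δ, hδ, H⟩ := huc (ε / 2) (by linarith)
    filter_upwards [(Metric.tendsto_nhds.1 ha) δ hδ] with n hn
    rw [← integral_sub (hint _ _ _ (hgc _) (hgb _ (hav (μs n))))
      (hint _ _ _ (hgc _) (hgb _ (hav μ))), dist_zero_right]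
    have := norm_integral_le_of_norm_le_const (μ := μs n)
      (f := fun x => |f x - ∫ y, f y ∂(μs n)| ^ p - |f x - ∫ y, f y ∂μ| ^ p) (C := ε / 2)
      (Eventually.of_forall fun x => by
        have := H (f x - ∫ y, f y ∂(μs n)) (abs_le.1 (hmem x _ (hav _)))
          (f x - ∫ y, f y ∂μ) (abs_le.1 (hmem x _ (hav _))) (by
            rw [dist_sub_left]; exact hn)
        rw [Real.dist_eq] at this
        exact this.le)
    simp only [probReal_univ, mul_one] at this
    linarith
  have h3 := h2.add h1
  simp only [sub_add_cancel, zero_add] at h3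
  have h4 := ENNReal.tendsto_ofReal h3
  rw [heq μ, ← h4.liminf_eq]
  refine liminf_le_liminf (Eventually.of_forall fun n => ?_)
  rw [← heq (μs n)]
  exact le_iSup₂ (f := fun (f : Y → ℝ)
    (_ : f ∈ {f : Y → ℝ | LipschitzWith 1 f ∧ ∃ C : ℝ, ∀ x, |f x| ≤ C}) =>
    ∫⁻ x, ENNReal.ofReal (|f x - ∫ y, f y ∂(μs n)| ^ p) ∂(μs n)) f hf
end

section
/- Let p, q be reals with 1 ≤ p ≤ q and q > 1, let C ∈ [0,∞), let Y be a complete separable metric space, and let μ_n (n ∈ ℕ) and μ be Borel probability measures on Y with μ_n converging weakly to μ. Suppose that for every n and every bounded Lipschitz function f : Y → ℝ one has (∫_Y |f − ∫_Y f dμ_n|^p dμ_n)^{1/p} ≤ C (∫_Y lip_a(f)^q dμ_n)^{1/q}. Then the same inequality holds for μ: for every bounded Lipschitz f : Y → ℝ, (∫_Y |f − ∫_Y f dμ|^p dμ)^{1/p} ≤ C (∫_Y lip_a(f)^q dμ)^{1/q}. (In other words, the set of probability measures satisfying the (p,q)-Poincaré inequality with constant C is closed under weak convergence.) -/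
open MeasureTheory ENNReal NNReal Filter

/-- The Lipschitz constant of `f` restricted to a set `s`, valued in `[0,∞]`. -/
noncomputable def lipConstOn {Y : Type*} [MetricSpace Y] (f : Y → ℝ) (s : Set Y) : ℝ≥0∞ :=
  ⨆ (y ∈ s) (z ∈ s) (_ : y ≠ z), edist (f y) (f z) / edist y z

/-- The asymptotic Lipschitz constant of `f` at `x`:
`lip_a(f)(x) = inf_{r>0} Lip(f|_{B_r(x)})`, valued in `[0,∞]`. -/
noncomputable def asympLip {Y : Type*} [MetricSpace Y] (f : Y → ℝ) (x : Y) : ℝ≥0∞ :=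
  ⨅ (r : ℝ) (_ : 0 < r), lipConstOn f (Metric.closedBall x r)

/-- The `(p,q)`-Poincaré inequality with constant `C` for a Borel probability measure `μ`:
`(∫ |f − ∫ f dμ|^p dμ)^(1/p) ≤ C (∫ lip_a(f)^q dμ)^(1/q)` for every bounded Lipschitz `f`. -/
def PoincareIneq {Y : Type*} [MetricSpace Y] [MeasurableSpace Y]
    (p q : ℝ) (C : ℝ) (μ : Measure Y) : Prop :=
  ∀ f : Y → ℝ, (∃ K : ℝ≥0, LipschitzWith K f) → (∃ C' : ℝ, ∀ x, |f x| ≤ C') →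
    (∫⁻ x, ENNReal.ofReal (|f x - ∫ y, f y ∂μ| ^ p) ∂μ) ^ (1 / p) ≤
      ENNReal.ofReal C * (∫⁻ x, asympLip f x ^ q ∂μ) ^ (1 / q)

theorem lipConstOn_mono' {Y : Type*} [MetricSpace Y] (f : Y → ℝ) {s t : Set Y} (h : s ⊆ t) :
    lipConstOn f s ≤ lipConstOn f t := by
  unfold lipConstOn
  refine iSup₂_le fun y hy => iSup₂_le fun z hz => iSup_le fun hne => ?_
  exact le_iSup₂_of_le y (h hy) (le_iSup₂_of_le z (h hz) (le_iSup_of_le hne le_rfl))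

theorem asympLip_le' {Y : Type*} [MetricSpace Y] {f : Y → ℝ} {K : ℝ≥0} (hf : LipschitzWith K f)
    (x : Y) : asympLip f x ≤ K := by
  unfold asympLip lipConstOn
  refine iInf₂_le_of_le 1 one_pos ?_
  refine iSup₂_le fun y hy => iSup₂_le fun z hz => iSup_le fun hne => ?_
  exact ENNReal.div_le_of_le_mul (hf y z)

theorem asympLip_isOpen {Y : Type*} [MetricSpace Y] (f : Y → ℝ) (a : ℝ≥0∞) :
    IsOpen {x | asympLip f x < a} := by
  rw [Metric.isOpen_iff]
  intro x hx
  simp only [Set.mem_setOf_eq, asympLip, iInf_lt_iff] at hx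
  obtain ⟨r, hr, hlt⟩ := hx
  refine ⟨r / 2, by positivity, fun y hy => ?_⟩
  refine lt_of_le_of_lt (iInf₂_le (r / 2) (by positivity)) (lt_of_le_of_lt ?_ hlt)
  apply lipConstOn_mono'
  apply Metric.closedBall_subset_closedBall'
  rw [Metric.mem_ball] at hy
  linarith

theorem usc_limsup {Y : Type*} [MetricSpace Y] [MeasurableSpace Y] [BorelSpace Y]
    (μs : ℕ → Measure Y) (μ : Measure Y)
    [∀ n, IsProbabilityMeasure (μs n)] [IsProbabilityMeasure μ]
    (hconv : ∀ g : Y → ℝ, Continuous g → (∃ C' : ℝ, ∀ x, |g x| ≤ C') →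
      Tendsto (fun n => ∫ x, g x ∂(μs n)) atTop (nhds (∫ x, g x ∂μ)))
    (u : Y → ℝ) (hu0 : ∀ x, 0 ≤ u x) (M : ℝ) (huM : ∀ x, u x ≤ M)
    (hcl : ∀ a, IsClosed {x | a ≤ u x}) :
    limsup (fun n => ∫⁻ x, ENNReal.ofReal (u x) ∂(μs n)) atTop ≤
      ∫⁻ x, ENNReal.ofReal (u x) ∂μ := by
  have hmeas : Measurable u := measurable_of_Ici fun a => (hcl a).measurableSet
  have hlc : ∀ ν : Measure Y, ∫⁻ x, ENNReal.ofReal (u x) ∂ν =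
      ∫⁻ t in Set.Ioi (0 : ℝ), ν {x | t ≤ u x} := fun ν =>
    lintegral_eq_lintegral_meas_le ν (Eventually.of_forall hu0) hmeas.aemeasurable
  let P : ProbabilityMeasure Y := ⟨μ, inferInstance⟩
  let Ps : ℕ → ProbabilityMeasure Y := fun n => ⟨μs n, inferInstance⟩
  have hT : Tendsto Ps atTop (nhds P) := by
    rw [ProbabilityMeasure.tendsto_iff_forall_integral_tendsto]
    intro g
    exact hconv g g.continuous ⟨‖g‖, fun x => g.norm_coe_le_norm x⟩
  have hF : ∀ t, limsup (fun n => μs n {x | t ≤ u x}) atTop ≤ μ {x | t ≤ u x} := fun t =>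
    ProbabilityMeasure.limsup_measure_closed_le_of_tendsto hT (hcl t)
  simp only [hlc]
  have hanti : ∀ ν : Measure Y, Measurable fun t : ℝ => ν {x | t ≤ u x} := fun ν =>
    Antitone.measurable fun s t hst => measure_mono fun x hx => le_trans hst hx
  refine (limsup_lintegral_le (Set.indicator (Set.Iic M) 1) (fun n => hanti (μs n)) ?_ ?_).trans
    (lintegral_mono fun t => hF t)
  · intro n
    refine Eventually.of_forall fun t => ?_
    by_cases ht : t ≤ M
    · simpa [Set.indicator, ht] using prob_le_one
    · have : {x | t ≤ u x} = ∅ := by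
        ext x
        simpa using (huM x).trans_lt (not_le.1 ht)
      simp [this]
  · rw [lintegral_indicator_one measurableSet_Iic, Measure.restrict_apply measurableSet_Iic]
    rw [show Set.Iic M ∩ Set.Ioi 0 = Set.Ioc 0 M by ext; simp [and_comm]]
    simp

theorem eLp_form {Y : Type*} [MeasurableSpace Y] (ν : Measure Y) (f : Y → ℝ) (m p : ℝ)
    (hp : 1 ≤ p) :
    (∫⁻ x, ENNReal.ofReal (|f x - m| ^ p) ∂ν) ^ (1 / p) =
      eLpNorm (fun x => f x - m) (ENNReal.ofReal p) ν := by
  have hp0 : 0 < p := by linarith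
  rw [eLpNorm_eq_lintegral_rpow_enorm_toReal (by simpa using hp0) (by simp),
    ENNReal.toReal_ofReal hp0.le]
  congr 1
  refine lintegral_congr fun x => ?_
  rw [← ENNReal.ofReal_rpow_of_nonneg (abs_nonneg _) hp0.le, Real.enorm_eq_ofReal_abs]

theorem poincare_closed_weak_conv {Y : Type*} [MetricSpace Y] [CompleteSpace Y]
    [TopologicalSpace.SeparableSpace Y] [MeasurableSpace Y] [BorelSpace Y]
    (p q : ℝ) (hp : 1 ≤ p) (hpq : p ≤ q) (hq : 1 < q) (C : ℝ) (hC : 0 ≤ C)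
    (μs : ℕ → Measure Y) (μ : Measure Y)
    [∀ n, IsProbabilityMeasure (μs n)] [IsProbabilityMeasure μ]
    (hconv : ∀ g : Y → ℝ, Continuous g → (∃ C' : ℝ, ∀ x, |g x| ≤ C') →
      Tendsto (fun n => ∫ x, g x ∂(μs n)) atTop (nhds (∫ x, g x ∂μ)))
    (hPI : ∀ n, PoincareIneq p q C (μs n)) :
    PoincareIneq p q C μ := by
  intro f hf hb
  have hfc : Continuous f := hf.choose_spec.continuous
  obtain ⟨K, hK⟩ := hf
  obtain ⟨B, hB⟩ := hb
  have hq0 : 0 < q := by linarith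
  have hp0 : 0 < p := by linarith
  have hle : ∀ x, asympLip f x ^ q ≤ (K : ℝ≥0∞) ^ q := fun x =>
    ENNReal.rpow_le_rpow (asympLip_le' hK x) hq0.le
  have hKq : (K : ℝ≥0∞) ^ q ≠ ⊤ := ENNReal.rpow_ne_top_of_nonneg hq0.le ENNReal.coe_ne_top
  have hne : ∀ x, asympLip f x ^ q ≠ ⊤ := fun x => ne_top_of_le_ne_top hKq (hle x)
  have husc : limsup (fun n => ∫⁻ x, asympLip f x ^ q ∂(μs n)) atTop ≤
      ∫⁻ x, asympLip f x ^ q ∂μ := by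
    have := usc_limsup μs μ hconv (fun x => (asympLip f x ^ q).toReal)
      (fun x => ENNReal.toReal_nonneg) ((K : ℝ≥0∞) ^ q).toReal
      (fun x => ENNReal.toReal_mono hKq (hle x)) ?_
    · simpa only [ENNReal.ofReal_toReal (hne _)] using this
    · intro a
      rw [← isOpen_compl_iff]
      by_cases ha : 0 < a
      · convert asympLip_isOpen f (ENNReal.ofReal a ^ (1 / q)) using 1
        ext x
        simp only [Set.mem_compl_iff, Set.mem_setOf_eq, not_le]
        rw [← ENNReal.lt_ofReal_iff_toReal_lt (hne x), one_div,
          ENNReal.lt_rpow_inv_iff hq0]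
      · convert isOpen_empty using 1
        ext x
        simpa using (not_lt.1 ha).trans (ENNReal.toReal_nonneg (a := asympLip f x ^ q))
  set U := ∫⁻ x, asympLip f x ^ q ∂μ with hU
  have hUtop : U ≠ ⊤ := by
    refine ne_top_of_le_ne_top hKq ((lintegral_mono hle).trans ?_)
    simp
  set m := ∫ y, f y ∂μ with hm
  have hmn : Tendsto (fun n => ‖(∫ y, f y ∂(μs n)) - m‖ₑ) atTop (nhds 0) := by
    have h1 := hconv f hfc ⟨B, hB⟩
    have h2 := (h1.sub_const m).enorm
    simpa [← hm] using h2
  have hL : Tendsto (fun n => (∫⁻ x, ENNReal.ofReal (|f x - m| ^ p) ∂(μs n)) ^ (1 / p)) atTop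
      (nhds ((∫⁻ x, ENNReal.ofReal (|f x - m| ^ p) ∂μ) ^ (1 / p))) := by
    have hgc : Continuous fun x => |f x - m| ^ p :=
      (hfc.sub continuous_const).abs.rpow_const fun x => Or.inr hp0.le
    have hgb : ∀ x, |(|f x - m| ^ p)| ≤ (B + |m|) ^ p := fun x => by
      rw [abs_of_nonneg (by positivity)]
      refine Real.rpow_le_rpow (abs_nonneg _) ?_ hp0.le
      exact (abs_sub _ _).trans (by linarith [hB x])
    have hint : ∀ ν : Measure Y, IsProbabilityMeasure ν →
        ∫⁻ x, ENNReal.ofReal (|f x - m| ^ p) ∂ν = ENNReal.ofReal (∫ x, |f x - m| ^ p ∂ν) := by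
      intro ν _
      rw [ofReal_integral_eq_lintegral_ofReal]
      · exact Integrable.of_bound hgc.aestronglyMeasurable _ (Eventually.of_forall hgb)
      · exact Eventually.of_forall fun x => by positivity
    rw [hint μ inferInstance]
    simp only [fun n => hint (μs n) inferInstance]
    exact (ENNReal.tendsto_ofReal (hconv _ hgc ⟨_, hgb⟩)).ennrpow_const _
  have hn : ∀ n, (∫⁻ x, ENNReal.ofReal (|f x - m| ^ p) ∂(μs n)) ^ (1 / p) ≤
      ENNReal.ofReal C * (∫⁻ x, asympLip f x ^ q ∂(μs n)) ^ (1 / q) +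
        ‖(∫ y, f y ∂(μs n)) - m‖ₑ := by
    intro n
    have h1 := hPI n f ⟨K, hK⟩ ⟨B, hB⟩
    rw [eLp_form _ _ _ _ hp] at h1 ⊢
    have h2 : (fun x => f x - m) = (fun x => f x - ∫ y, f y ∂(μs n)) +
        fun _ => (∫ y, f y ∂(μs n)) - m := by
      ext x
      simp
    rw [h2]
    refine (eLpNorm_add_le (hfc.sub continuous_const).aestronglyMeasurable
      aestronglyMeasurable_const (by simpa using hp)).trans (add_le_add h1 ?_)
    rw [eLpNorm_const _ (by simpa using hp0) (IsProbabilityMeasure.ne_zero _)]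
    simp
  have hb : ∀ b, U < b → (∫⁻ x, ENNReal.ofReal (|f x - m| ^ p) ∂μ) ^ (1 / p) ≤
      ENNReal.ofReal C * b ^ (1 / q) := by
    intro b hb
    have hev := eventually_lt_of_limsup_lt (husc.trans_lt hb)
    have h3 := (tendsto_const_nhds (x := ENNReal.ofReal C * b ^ (1 / q))).add hmn
    rw [add_zero] at h3
    refine le_of_tendsto_of_tendsto hL h3 ?_
    filter_upwards [hev] with n hn'
    refine (hn n).trans ?_
    gcongr
  have hcont : Tendsto (fun b : ℝ≥0∞ => ENNReal.ofReal C * b ^ (1 / q)) (nhdsWithin U (Set.Ioi U))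
      (nhds (ENNReal.ofReal C * U ^ (1 / q))) := by
    refine Tendsto.mono_left ?_ nhdsWithin_le_nhds
    exact ENNReal.Tendsto.const_mul ((ENNReal.continuous_rpow_const).tendsto U)
      (Or.inr ENNReal.ofReal_ne_top)
  haveI : (nhdsWithin U (Set.Ioi U)).NeBot := nhdsGT_neBot_of_exists_gt ⟨⊤, hUtop.lt_top⟩
  exact ge_of_tendsto hcont (eventually_mem_nhdsWithin.mono fun b h => hb b h)
end

section
/- Let X be a complete separable metric space with Borel probability measure m and let κ : ℕ → ℝ. Then inf_{δ>0} Sep(X; (κ_i − δ)_{i≥1}) = Sep(X; κ); that is, the separation distance of X is left-continuous with respect to uniform downward perturbations of the parameters κ. -/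
open MeasureTheory ENNReal

/-- The distance between two subsets, `inf {d(x,y) : x ∈ A, y ∈ B}`, valued in `[0,∞]`;
it is `∞` when either set is empty. -/
noncomputable def setDist {X : Type*} [MetricSpace X] (A B : Set X) : ℝ≥0∞ :=
  ⨅ (x ∈ A) (y ∈ B), edist x y

/-- The separation distance `sepDistance(X;κ)` of a metric measure space with respect to a
sequence `κ : ℕ → ℝ` of parameters: the supremum over all sequences `(A i)` of closed
subsets with `m (A i) ≥ κ i` of `inf_{i ≠ j} d(A i, A j)`. -/
noncomputable def sepDistance {X : Type*} [MetricSpace X] [MeasurableSpace X]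
    (m : Measure X) (κ : ℕ → ℝ) : ℝ≥0∞ :=
  ⨆ A ∈ {A : ℕ → Set X | (∀ i, IsClosed (A i)) ∧ ∀ i, ENNReal.ofReal (κ i) ≤ m (A i)},
    ⨅ (i : ℕ) (j : ℕ) (_ : i ≠ j), setDist (A i) (A j)

def limSet {X : Type*} [MetricSpace X] (U : Ultrafilter ℕ) (A : ℕ → Set X) : Set X :=
  {x | ∀ V ∈ nhds x, ∀ᶠ n in (U : Filter ℕ), (V ∩ A n).Nonempty}

lemma isClosed_limSet {X : Type*} [MetricSpace X] (U : Ultrafilter ℕ) (A : ℕ → Set X) :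
    IsClosed (limSet U A) := by
  rw [← isOpen_compl_iff, isOpen_iff_mem_nhds]
  intro x hx
  simp only [limSet, Set.mem_compl_iff, Set.mem_setOf_eq, not_forall] at hx
  obtain ⟨V, hV, hn⟩ := hx
  filter_upwards [eventually_mem_nhds_iff.mpr hV] with y hy hy'
  exact hn (hy' V hy)

lemma compact_limSet {X : Type*} [MetricSpace X] (U : Ultrafilter ℕ) (A : ℕ → Set X)
    (K : Set X) (hK : IsCompact K) (h : Disjoint K (limSet U A)) :
    ∀ᶠ n in (U : Filter ℕ), Disjoint K (A n) := by
  refine hK.induction_on (p := fun s => ∀ᶠ n in (U : Filter ℕ), Disjoint s (A n)) ?_ ?_ ?_ ?_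
  · simp
  · intro s t hst ht
    filter_upwards [ht] with n hn using hn.mono_left hst
  · intro s t hs ht
    filter_upwards [hs, ht] with n h1 h2 using Set.disjoint_union_left.mpr ⟨h1, h2⟩
  · intro x hx
    have hx' : x ∉ limSet U A := Set.disjoint_left.mp h hx
    simp only [limSet, Set.mem_setOf_eq, not_forall] at hx'
    obtain ⟨V, hV, hn⟩ := hx'
    refine ⟨V, mem_nhdsWithin_of_mem_nhds hV, ?_⟩
    rw [← Ultrafilter.eventually_not] at hn
    filter_upwards [hn] with n hn
    rwa [Set.disjoint_iff_inter_eq_empty, ← Set.not_nonempty_iff_eq_empty]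

lemma measure_limSet {X : Type*} [MetricSpace X] [CompleteSpace X]
    [TopologicalSpace.SeparableSpace X] [MeasurableSpace X] [BorelSpace X]
    (m : Measure X) [IsProbabilityMeasure m] (U : Ultrafilter ℕ)
    (hU : (U : Filter ℕ) ≤ Filter.atTop) (A : ℕ → Set X) (k : ℝ)
    (h : ∀ n : ℕ, ENNReal.ofReal (k - 1 / ((n : ℝ) + 1)) ≤ m (A n)) :
    ENNReal.ofReal k ≤ m (limSet U A) := by
  haveI : SecondCountableTopology X := UniformSpace.secondCountable_of_separable X
  have key : ∀ ρ : ℝ, 0 < ρ → ENNReal.ofReal k ≤ m (Metric.thickening ρ (limSet U A)) := by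
    intro ρ hρ
    refine ENNReal.le_of_forall_pos_le_add fun ε hε _ => ?_
    have hε2 : (ENNReal.ofReal (ε / 2)) ≠ 0 := by
      have : (0 : ℝ) < ε / 2 := by positivity
      simpa using hε
    obtain ⟨K, -, hK, hKm⟩ := MeasurableSet.univ.exists_isCompact_diff_lt (μ := m)
      (measure_ne_top _ _) hε2
    have hc := compact_limSet U A (K \ Metric.thickening ρ (limSet U A))
      (hK.diff Metric.isOpen_thickening)
      (Set.disjoint_left.mpr fun x hx hx' =>
        hx.2 (Metric.self_subset_thickening hρ _ hx'))
    have hd : ∀ᶠ n : ℕ in (U : Filter ℕ), 1 / ((n : ℝ) + 1) < ε / 2 :=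
      hU ((tendsto_one_div_add_atTop_nhds_zero_nat (𝕜 := ℝ)).eventually_lt_const
        (by positivity))
    obtain ⟨n, hn1, hn2⟩ := (hc.and hd).exists
    have hsub : A n ⊆ Metric.thickening ρ (limSet U A) ∪ (Set.univ \ K) := by
      intro x hx
      by_contra hcon
      simp only [Set.mem_union, Set.mem_diff, Set.mem_univ, true_and, not_or, not_not] at hcon
      exact Set.disjoint_left.mp hn1 ⟨hcon.2, hcon.1⟩ hx
    calc ENNReal.ofReal k
        ≤ ENNReal.ofReal ((k - 1 / ((n : ℝ) + 1)) + ε / 2) :=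
          ENNReal.ofReal_le_ofReal (by linarith)
      _ ≤ ENNReal.ofReal (k - 1 / ((n : ℝ) + 1)) + ENNReal.ofReal (ε / 2) :=
          ENNReal.ofReal_add_le
      _ ≤ (m (Metric.thickening ρ (limSet U A)) + ENNReal.ofReal (ε / 2))
            + ENNReal.ofReal (ε / 2) := by
          gcongr
          exact (h n).trans ((measure_mono hsub).trans ((measure_union_le _ _).trans (by gcongr)))
      _ = m (Metric.thickening ρ (limSet U A)) + ε := by
          rw [add_assoc, ← ENNReal.ofReal_add (by positivity) (by positivity), add_halves,
            ENNReal.ofReal_coe_nnreal]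
  refine ge_of_tendsto (tendsto_measure_thickening_of_isClosed (μ := m)
    ⟨1, one_pos, measure_ne_top _ _⟩ (isClosed_limSet U A)) ?_
  filter_upwards [self_mem_nhdsWithin] with ρ hρ using key ρ hρ

lemma setDist_limSet {X : Type*} [MetricSpace X] (U : Ultrafilter ℕ) (A B : ℕ → Set X)
    (c : ℝ≥0∞) (h : ∀ n, c ≤ setDist (A n) (B n)) :
    c ≤ setDist (limSet U A) (limSet U B) := by
  unfold setDist
  refine le_iInf₂ fun x hx => le_iInf₂ fun y hy => ?_
  refine ENNReal.le_of_forall_pos_le_add fun ε hε _ => ?_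
  have hε2 : (0 : ℝ≥0∞) < (ε : ℝ≥0∞) / 2 := by
    simpa using hε.ne'
  obtain ⟨n, ⟨x', hx1, hx2⟩, ⟨y', hy1, hy2⟩⟩ :=
    ((hx _ (Metric.eball_mem_nhds x hε2)).and (hy _ (Metric.eball_mem_nhds y hε2))).exists
  have h1 : c ≤ edist x' y' := (h n).trans (iInf₂_le_of_le x' hx2 (iInf₂_le y' hy2))
  rw [Metric.mem_eball] at hx1 hy1
  rw [edist_comm] at hy1
  calc c ≤ edist x' y' := h1
    _ ≤ edist x' x + edist x y + edist y y' := edist_triangle4 _ _ _ _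
    _ ≤ ε / 2 + edist x y + ε / 2 := by gcongr
    _ = edist x y + ε := by
      rw [add_comm ((ε : ℝ≥0∞) / 2), add_assoc, ENNReal.add_halves]

/-- The separation distance is left-continuous in the parameters `κ` with respect to
uniform downward perturbations: `inf_{δ>0} sepDistance(X; κ − δ) = sepDistance(X; κ)`. -/
theorem sep_left_continuous {X : Type*} [MetricSpace X] [CompleteSpace X]
    [TopologicalSpace.SeparableSpace X] [MeasurableSpace X] [BorelSpace X]
    (m : Measure X) [IsProbabilityMeasure m] (κ : ℕ → ℝ) :
    (⨅ (δ : ℝ) (_ : 0 < δ), sepDistance m (fun i => κ i - δ)) = sepDistance m κ := by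
  apply le_antisymm
  · refine le_of_forall_lt fun c hc => ?_
    obtain ⟨c', hcc', hc'⟩ := exists_between hc
    refine hcc'.trans_le ?_
    have hex : ∀ n : ℕ, ∃ A : ℕ → Set X, (∀ i, IsClosed (A i)) ∧
        (∀ i, ENNReal.ofReal (κ i - 1 / ((n : ℝ) + 1)) ≤ m (A i)) ∧
        ∀ i j, i ≠ j → c' ≤ setDist (A i) (A j) := by
      intro n
      have h1 : c' < sepDistance m (fun i => κ i - 1 / ((n : ℝ) + 1)) :=
        hc'.trans_le (iInf₂_le _ (by positivity))
      unfold sepDistance at h1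
      simp only [lt_iSup_iff] at h1
      obtain ⟨A, hA, hlt⟩ := h1
      refine ⟨A, hA.1, hA.2, fun i j hij => hlt.le.trans ?_⟩
      exact iInf_le_of_le i (iInf₂_le j hij)
    choose A _ hA2 hA3 using hex
    have hU : ((Filter.hyperfilter ℕ : Ultrafilter ℕ) : Filter ℕ) ≤ Filter.atTop :=
      Nat.hyperfilter_le_atTop
    unfold sepDistance
    refine le_iSup₂_of_le (fun i => limSet (Filter.hyperfilter ℕ) (fun n => A n i))
      ⟨fun i => isClosed_limSet _ _, fun i => measure_limSet m _ hU _ _ fun n => hA2 n i⟩ ?_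
    exact le_iInf fun i => le_iInf₂ fun j hij =>
      setDist_limSet _ _ _ _ fun n => hA3 n i j hij
  · refine le_iInf₂ fun δ hδ => ?_
    unfold sepDistance
    refine biSup_mono fun A hA => ⟨hA.1, fun i => le_trans ?_ (hA.2 i)⟩
    exact ENNReal.ofReal_le_ofReal (by linarith)
end

section
/- Define Ψ(t) := (2π)^{-1/2} ∫_0^t e^{-s²/2} ds for t ≥ 0. For every σ with 0 < σ < 1/√(2π), there exists κ ∈ (0,1) such that Ψ((1−κ)/(2σ)) > (1−κ)/2. (Equivalently, 2σ Ψ^{-1}((1−κ)/2) < 1−κ, i.e., the κ-observable diameter of the infinite-dimensional Gaussian space of variance σ² is strictly less than 1−κ.) -/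
open Real

/-- `Ψ(t) = (2π)^{-1/2} ∫_0^t e^{-s²/2} ds`, the cumulative mass of the standard
Gaussian measure on `[0,t]`. -/
noncomputable def Psi (t : ℝ) : ℝ :=
  (Real.sqrt (2 * Real.pi))⁻¹ * ∫ s in (0 : ℝ)..t, Real.exp (-s ^ 2 / 2)

/-- For every `0 < σ < 1/√(2π)` there exists `κ ∈ (0,1)` with
`Ψ((1−κ)/(2σ)) > (1−κ)/2`; equivalently, the κ-observable diameter
`2σ Ψ⁻¹((1−κ)/2)` of the infinite-dimensional Gaussian space of variance `σ²` is
strictly less than `1−κ`. -/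
theorem exists_kappa_obsdiam_lt (σ : ℝ) (hσ : 0 < σ) (hσ' : σ < 1 / Real.sqrt (2 * Real.pi)) :
    ∃ κ : ℝ, 0 < κ ∧ κ < 1 ∧ (1 - κ) / 2 < Psi ((1 - κ) / (2 * σ)) := by
  have hc : HasDerivAt Psi ((Real.sqrt (2 * Real.pi))⁻¹ * Real.exp (-(0:ℝ) ^ 2 / 2)) 0 := by
    have hcont : Continuous (fun s : ℝ => Real.exp (-s ^ 2 / 2)) := by fun_prop
    exact (intervalIntegral.integral_hasDerivAt_right (hcont.intervalIntegrable 0 0)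
      (hcont.stronglyMeasurableAtFilter _ _) hcont.continuousAt).const_mul _
  have h0 : Psi 0 = 0 := by simp [Psi]
  have hlt : σ < (Real.sqrt (2 * Real.pi))⁻¹ * Real.exp (-(0:ℝ) ^ 2 / 2) := by
    simpa using hσ'
  have h1 := (hasDerivAt_iff_tendsto_slope.mp hc).eventually (lt_mem_nhds hlt)
  have h2 : ∀ᶠ t in nhdsWithin (0:ℝ) (Set.Ioi 0), σ < slope Psi 0 t :=
    h1.filter_mono (nhdsWithin_mono _ (fun x hx => ne_of_gt hx))
  have hpos : (0:ℝ) < 1 / (2 * σ) := by positivity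
  obtain ⟨t, ht, ht0, ht1⟩ := (h2.and (Ioo_mem_nhdsGT hpos)).exists
  rw [lt_div_iff₀ (by positivity)] at ht1
  rw [slope_def_field, h0, sub_zero, sub_zero, lt_div_iff₀ ht0] at ht
  have hp : 0 < t * (2 * σ) := by positivity
  refine ⟨1 - t * (2 * σ), by linarith, by linarith, ?_⟩
  have e : (1 - (1 - t * (2 * σ))) / (2 * σ) = t := by
    field_simp
    ring
  rw [e]
  linarith
end

section
/- Let Y be a complete separable metric space, let N ≥ 1, and let α : ℕ → [0,∞) satisfy α_i = 0 for all i > N and ∑_{i=1}^N α_i ≤ 1. Let μ_n (n ∈ ℕ) and μ be Borel probability measures on Y with μ_n converging weakly to μ, and suppose each μ_n has atoms α, i.e., there exist maps f_n : {1,…,N} → Y with ∑_{i=1}^N α_i δ_{f_n(i)} ≤ μ_n. Then μ has atoms α: there exists f : {1,…,N} → Y with ∑_{i=1}^N α_i δ_{f(i)} ≤ μ. (The class of probability measures with atoms α is closed under weak convergence when α is finitely supported.) -/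
open MeasureTheory ENNReal Filter

/-- The class of Borel probability measures carrying a fixed finite atom pattern
`α : Fin N → [0,∞)` is closed under weak convergence: if each `μ_n` admits points
`f_n : Fin N → Y` with `∑ i, α_i δ_{f_n(i)} ≤ μ_n` and `μ_n → μ` weakly, then `μ`
admits points `f : Fin N → Y` with `∑ i, α_i δ_{f(i)} ≤ μ`. -/
theorem hasAtoms_closed_weak_conv {Y : Type*} [MetricSpace Y] [CompleteSpace Y]
    [TopologicalSpace.SeparableSpace Y] [MeasurableSpace Y] [BorelSpace Y]
    (N : ℕ) (hN : 1 ≤ N) (α : Fin N → ℝ) (hα : ∀ i, 0 ≤ α i) (hsum : ∑ i, α i ≤ 1)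
    (μs : ℕ → Measure Y) (μ : Measure Y)
    [∀ n, IsProbabilityMeasure (μs n)] [IsProbabilityMeasure μ]
    (hconv : ∀ g : Y → ℝ, Continuous g → (∃ C : ℝ, ∀ x, |g x| ≤ C) →
      Tendsto (fun n => ∫ x, g x ∂(μs n)) atTop (nhds (∫ x, g x ∂μ)))
    (hatoms : ∀ n, ∃ f : Fin N → Y,
      (∑ i, ENNReal.ofReal (α i) • Measure.dirac (f i)) ≤ μs n) :
    ∃ f : Fin N → Y, (∑ i, ENNReal.ofReal (α i) • Measure.dirac (f i)) ≤ μ := by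
  classical
  have : SecondCountableTopology Y := UniformSpace.secondCountable_of_separable Y
  choose f hf using hatoms
  set U : Filter ℕ := (hyperfilter ℕ : Filter ℕ) with hU
  have hUat : U ≤ atTop := Nat.hyperfilter_le_atTop
  -- portmanteau
  have key : ∀ (c : ℝ≥0∞) (F : Set Y), IsClosed F → (∃ᶠ n in U, c ≤ μs n F) → c ≤ μ F := by
    intro c F hF hc
    let P : ProbabilityMeasure Y := ⟨μ, inferInstance⟩
    let Ps : ℕ → ProbabilityMeasure Y := fun n => ⟨μs n, inferInstance⟩
    have hlim : Tendsto Ps U (nhds P) := by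
      rw [ProbabilityMeasure.tendsto_iff_forall_integral_tendsto]
      intro g
      exact (hconv g g.continuous ⟨‖g‖, fun x => g.norm_coe_le_norm x⟩).mono_left hUat
    exact (le_limsup_of_frequently_le' hc).trans
      (ProbabilityMeasure.limsup_measure_closed_le_of_tendsto hlim hF)
  have hval : ∀ (y : Fin N → Y) (A : Set Y), MeasurableSet A →
      (∑ i, ENNReal.ofReal (α i) • Measure.dirac (y i)) A
        = ∑ i, if y i ∈ A then ENNReal.ofReal (α i) else 0 := by
    intro y A hA
    simp [Measure.finsetSum_apply, Measure.dirac_apply' _ hA, Set.indicator_apply]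
  have hex : ∀ i, ∃ y : Y, 0 < α i → Tendsto (fun n => f n i) U (nhds y) := by
    intro i
    by_cases hi : 0 < α i
    swap
    · exact ⟨f 0 i, fun h => absurd h hi⟩
    have ht : IsTightMeasureSet {μ} := isTightMeasureSet_singleton
    rw [isTightMeasureSet_iff_exists_isCompact_measure_compl_le] at ht
    obtain ⟨K₀, hK₀, hKμ₀⟩ := ht (ENNReal.ofReal (α i / 2)) (by simpa using hi)
    obtain ⟨K, hK, hne, hKμ⟩ : ∃ K : Set Y, IsCompact K ∧ K.Nonempty ∧
        μ Kᶜ ≤ ENNReal.ofReal (α i / 2) :=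
      ⟨insert (f 0 i) K₀, hK₀.insert _, Set.insert_nonempty _ _,
        (measure_mono (Set.compl_subset_compl.2 (Set.subset_insert _ _))).trans (hKμ₀ μ rfl)⟩
    have hnear : ∀ ε > 0, ∀ᶠ n in U, Metric.infDist (f n i) K < ε := by
      intro ε hε
      by_contra hcon
      have hfr : ∃ᶠ n in U, ENNReal.ofReal (α i) ≤ μs n {x | ε ≤ Metric.infDist x K} := by
        refine (not_eventually.1 hcon).mono fun n hn => ?_
        have hcl : IsClosed {x | ε ≤ Metric.infDist x K} :=
          isClosed_le continuous_const (Metric.continuous_infDist_pt K)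
        refine le_trans ?_ (hf n _)
        rw [hval _ _ hcl.measurableSet]
        refine le_trans ?_ (Finset.single_le_sum (fun _ _ => zero_le) (Finset.mem_univ i))
        rw [if_pos]
        exact not_lt.1 hn
      have h1 := key _ _ (isClosed_le continuous_const (Metric.continuous_infDist_pt K)) hfr
      have h2 : μ {x | ε ≤ Metric.infDist x K} ≤ ENNReal.ofReal (α i / 2) := by
        refine (measure_mono ?_).trans hKμ
        intro x hx hxK
        have : Metric.infDist x K = 0 := Metric.infDist_zero_of_mem hxK
        simp only [Set.mem_setOf_eq, this] at hx
        linarith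
      have h3 := h1.trans h2
      rw [ENNReal.ofReal_le_ofReal_iff (by linarith)] at h3
      linarith
    choose x hxK hx using fun n => hK.exists_infDist_eq_dist hne (f n i)
    obtain ⟨y, -, hy⟩ := hK.ultrafilter_le_nhds ((hyperfilter ℕ).map x)
      (by
        rw [le_principal_iff]
        exact Eventually.of_forall (f := U) hxK)
    have hy' : Tendsto x U (nhds y) := hy
    refine ⟨y, fun _ => ?_⟩
    have hd : Tendsto (fun n => dist (x n) (f n i)) U (nhds 0) := by
      rw [Metric.tendsto_nhds]
      intro ε hε
      filter_upwards [hnear ε hε] with n hn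
      rw [hx n] at hn
      simpa [dist_comm] using hn
    exact (tendsto_iff_of_dist hd).1 hy'
  choose y hy using hex
  have hclosed : ∀ F : Set Y, IsClosed F →
      (∑ i, ENNReal.ofReal (α i) • Measure.dirac (y i)) F ≤ μ F := by
    intro F hF
    have hlim := tendsto_measure_cthickening_of_isClosed (μ := μ) ⟨1, one_pos, measure_ne_top _ _⟩ hF
    refine ge_of_tendsto (hlim.mono_left (nhdsWithin_le_nhds (s := Set.Ioi 0))) ?_
    filter_upwards [self_mem_nhdsWithin] with r hr
    have hr : 0 < r := hr
    refine key _ _ Metric.isClosed_cthickening (Eventually.frequently ?_)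
    have hall : ∀ᶠ n in U, ∀ i, 0 < α i → y i ∈ F → f n i ∈ Metric.cthickening r F := by
      rw [eventually_all]
      intro i
      by_cases hi : 0 < α i
      swap
      · exact Eventually.of_forall fun n h => absurd h hi
      filter_upwards [Metric.tendsto_nhds.1 (hy i hi) r hr] with n hn _ hF'
      exact Metric.mem_cthickening_of_dist_le _ _ _ _ hF' hn.le
    filter_upwards [hall] with n hn
    refine le_trans ?_ (hf n _)
    rw [hval _ _ hF.measurableSet, hval _ _ Metric.isClosed_cthickening.measurableSet]
    refine Finset.sum_le_sum fun i _ => ?_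
    rcases (hα i).eq_or_lt with h0 | h0
    · simp [← h0]
    by_cases hyF : y i ∈ F
    · rw [if_pos hyF, if_pos (hn i h0 hyF)]
    · simp [hyF]
  refine ⟨y, Measure.le_iff.2 fun A hA => ?_⟩
  have hfin : (Set.range y ∩ A).Finite := (Set.finite_range y).inter_of_left A
  refine le_trans (le_of_eq ?_) ((hclosed _ hfin.isClosed).trans (measure_mono Set.inter_subset_right))
  rw [hval _ _ hA, hval _ _ hfin.measurableSet]
  simp
end
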